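/- Let K = ℂ(u₁, u₂, u₃, c₁₁, c₁₂, c₁₃, c₂₂, c₂₃, c₃₃) be the field of rational functions in the nine coordinates of a pair (u, C) with C symmetric, equipped with the SO₃(ℂ)-action by field automorphisms induced by precomposition with the linear action (u,C) ↦ (gu, gCgᵀ). Then the fixed field K^{SO₃(ℂ)} is exactly the subfield ℂ(f₁, …, f₆) generated over ℂ by the six invariants f₁, …, f₆; in particular the field of rational SO₃(ℂ)-invariants of symmetric mixed states of two qubits is purely transcendental of transcendence degree 6 over ℂ. -/

import Mathlib

open Matrix MvPolynomial

/-- `SO₃(ℂ)`: complex 3×3 matrices with `gᵀ g = 1` and `det g = 1`. -/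
def SO3 (g : Matrix (Fin 3) (Fin 3) ℂ) : Prop := gᵀ * g = 1 ∧ g.det = 1

/-- The generic vector `u = (u₁, u₂, u₃)` with polynomial entries. -/
noncomputable def symU : Fin 3 → MvPolynomial (Fin 9) ℂ := ![X 0, X 1, X 2]

/-- The generic symmetric matrix `C = (cᵢⱼ)` with polynomial entries
`c₁₁, c₁₂, c₁₃, c₂₂, c₂₃, c₃₃`. -/
noncomputable def symC : Matrix (Fin 3) (Fin 3) (MvPolynomial (Fin 9) ℂ) :=
  !![X 3, X 4, X 5; X 4, X 6, X 7; X 5, X 7, X 8]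

/-- The six invariants `f₁, …, f₆` as polynomials in the nine coordinates of `(u, C)`. -/
noncomputable def symFpoly : Fin 6 → MvPolynomial (Fin 9) ℂ :=
  let u := symU
  let C := symC
  let v := crossProduct u (C *ᵥ u)
  let w := crossProduct u v
  ![u ⬝ᵥ u, v ⬝ᵥ v, u ⬝ᵥ (C *ᵥ u), v ⬝ᵥ (C *ᵥ v), w ⬝ᵥ (C *ᵥ w), w ⬝ᵥ (C *ᵥ v)]

/-- The SO₃(ℂ)-action on the nine coordinates of a pair `(u, C)` with `C` symmetric,
given by `(u, C) ↦ (gu, gCgᵀ)`. -/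
noncomputable def symAct (g : Matrix (Fin 3) (Fin 3) ℂ) (x : Fin 9 → ℂ) : Fin 9 → ℂ :=
  let u : Fin 3 → ℂ := ![x 0, x 1, x 2]
  let C : Matrix (Fin 3) (Fin 3) ℂ := !![x 3, x 4, x 5; x 4, x 6, x 7; x 5, x 7, x 8]
  let u' := g *ᵥ u
  let C' := g * C * gᵀ
  ![u' 0, u' 1, u' 2, C' 0 0, C' 0 1, C' 0 2, C' 1 1, C' 1 2, C' 2 2]

/-- The vector `u` of the pair `(u, C)` with coordinates `x`. -/
def vectorPart (x : Fin 9 → ℂ) : Fin 3 → ℂ := ![x 0, x 1, x 2]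

/-- The symmetric matrix `C` of the pair `(u, C)` with coordinates `x`. -/
def matrixPart (x : Fin 9 → ℂ) : Matrix (Fin 3) (Fin 3) ℂ :=
  !![x 3, x 4, x 5; x 4, x 6, x 7; x 5, x 7, x 8]

/-- The nine coordinates of a pair `(u, C)`. -/
def pairCoords {R : Type*} (u : Fin 3 → R) (C : Matrix (Fin 3) (Fin 3) R) : Fin 9 → R :=
  ![u 0, u 1, u 2, C 0 0, C 0 1, C 0 2, C 1 1, C 1 2, C 2 2]

/-- The values of the six invariants at a pair `(u, C)`. -/
def pairInvariants (u : Fin 3 → ℂ) (C : Matrix (Fin 3) (Fin 3) ℂ) : Fin 6 → ℂ :=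
  let v := crossProduct u (C *ᵥ u)
  let w := crossProduct u v
  ![u ⬝ᵥ u, v ⬝ᵥ v, u ⬝ᵥ (C *ᵥ u), v ⬝ᵥ (C *ᵥ v), w ⬝ᵥ (C *ᵥ w), w ⬝ᵥ (C *ᵥ v)]

/-- The values of the six invariants at the point with coordinates `x`. -/
def invariantsAt (x : Fin 9 → ℂ) : Fin 6 → ℂ := pairInvariants (vectorPart x) (matrixPart x)

theorem symAct_eq (g : Matrix (Fin 3) (Fin 3) ℂ) (x : Fin 9 → ℂ) :
    symAct g x = pairCoords (g *ᵥ vectorPart x) (g * matrixPart x * gᵀ) := rfl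

theorem vectorPart_pairCoords (u : Fin 3 → ℂ) (C : Matrix (Fin 3) (Fin 3) ℂ) :
    vectorPart (pairCoords u C) = u := by
  ext i; fin_cases i <;> rfl

theorem matrixPart_pairCoords (u : Fin 3 → ℂ) {C : Matrix (Fin 3) (Fin 3) ℂ} (hC : Cᵀ = C) :
    matrixPart (pairCoords u C) = C := by
  have h : ∀ i j, C j i = C i j := fun i j => congrFun (congrFun hC i) j
  ext i j
  fin_cases i <;> fin_cases j <;> first | rfl | exact h _ _

theorem pairCoords_parts (x : Fin 9 → ℂ) :
    pairCoords (vectorPart x) (matrixPart x) = x := by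
  ext i; fin_cases i <;> rfl

theorem transpose_matrixPart (x : Fin 9 → ℂ) : (matrixPart x)ᵀ = matrixPart x := by
  ext i j; fin_cases i <;> fin_cases j <;> rfl

theorem vectorPart_symAct (g : Matrix (Fin 3) (Fin 3) ℂ) (x : Fin 9 → ℂ) :
    vectorPart (symAct g x) = g *ᵥ vectorPart x := by
  rw [symAct_eq, vectorPart_pairCoords]

theorem matrixPart_symAct (g : Matrix (Fin 3) (Fin 3) ℂ) (x : Fin 9 → ℂ) :
    matrixPart (symAct g x) = g * matrixPart x * gᵀ := by
  rw [symAct_eq, matrixPart_pairCoords]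
  simp [transpose_mul, transpose_matrixPart, Matrix.mul_assoc]

theorem symAct_symAct (g h : Matrix (Fin 3) (Fin 3) ℂ) (x : Fin 9 → ℂ) :
    symAct g (symAct h x) = symAct (g * h) x := by
  rw [symAct_eq g, vectorPart_symAct, matrixPart_symAct, symAct_eq]
  simp [transpose_mul, Matrix.mul_assoc]

theorem symAct_one (x : Fin 9 → ℂ) : symAct 1 x = x := by
  simp [symAct_eq, pairCoords_parts]

theorem SO3.mul {g h : Matrix (Fin 3) (Fin 3) ℂ} (hg : SO3 g) (hh : SO3 h) : SO3 (g * h) := by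
  refine ⟨?_, by rw [det_mul, hg.2, hh.2, one_mul]⟩
  rw [transpose_mul, Matrix.mul_assoc, ← Matrix.mul_assoc gᵀ, hg.1, Matrix.one_mul, hh.1]

theorem SO3.transpose {g : Matrix (Fin 3) (Fin 3) ℂ} (hg : SO3 g) : SO3 gᵀ :=
  ⟨by rw [transpose_transpose]; exact mul_eq_one_comm.mp hg.1, by rw [det_transpose, hg.2]⟩

theorem SO3.dotProduct_mulVec {g : Matrix (Fin 3) (Fin 3) ℂ} (hg : SO3 g) (a b : Fin 3 → ℂ) :
    (g *ᵥ a) ⬝ᵥ (g *ᵥ b) = a ⬝ᵥ b := by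
  rw [Matrix.dotProduct_mulVec, ← mulVec_transpose, mulVec_mulVec, hg.1, one_mulVec]

theorem SO3.crossProduct_mulVec {g : Matrix (Fin 3) (Fin 3) ℂ} (hg : SO3 g)
    (a b : Fin 3 → ℂ) :
    crossProduct (g *ᵥ a) (g *ᵥ b) = g *ᵥ crossProduct a b := by
  have hadj : adjugate g = gᵀ := by
    have h := congrArg (gᵀ * ·) (mul_adjugate g)
    simpa [← Matrix.mul_assoc, hg.1, hg.2] using h
  rw [adjugate_fin_three] at hadj
  have h : ∀ i j, _ := fun i j => congrFun (congrFun hadj i) j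
  have h00 := h 0 0
  have h01 := h 0 1
  have h02 := h 0 2
  have h10 := h 1 0
  have h11 := h 1 1
  have h12 := h 1 2
  have h20 := h 2 0
  have h21 := h 2 1
  have h22 := h 2 2
  simp at h00 h01 h02 h10 h11 h12 h20 h21 h22
  ext i
  fin_cases i <;> simp [cross_apply, mulVec, dotProduct, Fin.sum_univ_three]
  · rw [← h00, ← h10, ← h20]; ring
  · rw [← h01, ← h11, ← h21]; ring
  · rw [← h02, ← h12, ← h22]; ring

theorem invariantsAt_symAct {g : Matrix (Fin 3) (Fin 3) ℂ} (hg : SO3 g) (x : Fin 9 → ℂ) :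
    invariantsAt (symAct g x) = invariantsAt x := by
  have hC : ∀ y, (g * matrixPart x * gᵀ) *ᵥ (g *ᵥ y) = g *ᵥ (matrixPart x *ᵥ y) := by
    intro y
    rw [mulVec_mulVec, Matrix.mul_assoc, hg.1, Matrix.mul_one, mulVec_mulVec]
  simp only [invariantsAt, vectorPart_symAct, matrixPart_symAct, pairInvariants, hC,
    hg.crossProduct_mulVec, hg.dotProduct_mulVec]

theorem eval_symFpoly (x : Fin 9 → ℂ) (i : Fin 6) :
    eval x (symFpoly i) = invariantsAt x i := by
  fin_cases i <;>
    simp [symFpoly, invariantsAt, pairInvariants, symU, symC, vectorPart, matrixPart,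
      cross_apply, mulVec, dotProduct, Fin.sum_univ_three]

theorem eval_aeval_symFpoly (x : Fin 9 → ℂ) (P : MvPolynomial (Fin 6) ℂ) :
    eval x (aeval symFpoly P) = eval (invariantsAt x) P := by
  induction P using MvPolynomial.induction_on with
  | C a => simp
  | add p q hp hq => rw [map_add, map_add, map_add, hp, hq]
  | mul_X p i hp => rw [map_mul, map_mul, map_mul, hp, aeval_X, eval_X, eval_symFpoly]

theorem exists_eval_symAct (g : Matrix (Fin 3) (Fin 3) ℂ) (p : MvPolynomial (Fin 9) ℂ) :
    ∃ p' : MvPolynomial (Fin 9) ℂ, ∀ x, eval x p' = eval (symAct g x) p := by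
  refine ⟨aeval (pairCoords (g.map C *ᵥ symU) (g.map C * symC * (g.map C)ᵀ)) p, fun x => ?_⟩
  have hX : ∀ i, eval x (pairCoords (g.map C *ᵥ symU) (g.map C * symC * (g.map C)ᵀ) i) =
      symAct g x i := by
    intro i
    fin_cases i <;>
      simp [symAct, pairCoords, symU, symC, mulVec, Matrix.mul_apply, dotProduct,
        Fin.sum_univ_three]
  induction p using MvPolynomial.induction_on with
  | C a => simp
  | add p q hp hq => rw [map_add, map_add, map_add, hp, hq]
  | mul_X p i hp => rw [map_mul, map_mul, map_mul, hp, aeval_X, eval_X, hX]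

/-- The point with invariants `a` whose vector is `(s, 0, 0)` and for which `u × Cu = (0, t, 0)`,
where `a 0 = s ^ 2` and `a 1 = t ^ 2`. -/
noncomputable def normalForm (s t : ℂ) (a : Fin 6 → ℂ) : Fin 9 → ℂ :=
  ![s, 0, 0, a 2 / a 0, 0, -t / a 0, a 3 / a 1, s * a 5 / (a 0 * a 1), a 4 / (a 0 * a 1)]

theorem invariantsAt_normalForm {s t : ℂ} {a : Fin 6 → ℂ} (hs : s ≠ 0) (ht : t ≠ 0)
    (h0 : a 0 = s ^ 2) (h1 : a 1 = t ^ 2) : invariantsAt (normalForm s t a) = a := by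
  ext i
  fin_cases i <;>
    simp [invariantsAt, pairInvariants, normalForm, vectorPart, matrixPart, cross_apply, mulVec,
      dotProduct, Fin.sum_univ_three, h0, h1] <;> field_simp

theorem eq_zero_of_eval_of_ne_zero {P : MvPolynomial (Fin 6) ℂ}
    (h : ∀ a : Fin 6 → ℂ, a 0 ≠ 0 → a 1 ≠ 0 → eval a P = 0) : P = 0 := by
  have h' : P * (X 0 * X 1) = 0 := by
    refine MvPolynomial.funext fun a => ?_
    by_cases h0 : a 0 = 0
    · simp [h0]
    by_cases h1 : a 1 = 0
    · simp [h1]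
    simp [h a h0 h1]
  exact (mul_eq_zero.mp h').resolve_right (mul_ne_zero (X_ne_zero _) (X_ne_zero _))

theorem exists_sq_eq_of_ne_zero {z : ℂ} (hz : z ≠ 0) : ∃ s : ℂ, s ≠ 0 ∧ z = s ^ 2 := by
  obtain ⟨s, hs⟩ := IsAlgClosed.exists_pow_nat_eq z (n := 2) two_pos
  refine ⟨s, ?_, hs.symm⟩
  rintro rfl
  exact hz (by simp [← hs])

theorem algebraicIndependent_symFpoly : AlgebraicIndependent ℂ symFpoly := by
  rw [algebraicIndependent_iff]
  refine fun P hP => eq_zero_of_eval_of_ne_zero fun a h0 h1 => ?_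
  obtain ⟨s, hs0, hs⟩ := exists_sq_eq_of_ne_zero h0
  obtain ⟨t, ht0, ht⟩ := exists_sq_eq_of_ne_zero h1
  rw [← invariantsAt_normalForm hs0 ht0 hs ht, ← eval_aeval_symFpoly, hP, map_zero]

theorem exists_SO3_symAct_eq_normalForm {x : Fin 9 → ℂ} {s t : ℂ} (hs : s ≠ 0) (ht : t ≠ 0)
    (h0 : invariantsAt x 0 = s ^ 2) (h1 : invariantsAt x 1 = t ^ 2) :
    ∃ g, SO3 g ∧ symAct g x = normalForm s t (invariantsAt x) := by
  set u := vectorPart x with hu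
  set M := matrixPart x with hM
  set v := crossProduct u (M *ᵥ u) with hv
  set w := crossProduct u v with hw
  have hMs : ∀ a b, a ⬝ᵥ (M *ᵥ b) = b ⬝ᵥ (M *ᵥ a) := by
    intro a b
    rw [Matrix.dotProduct_mulVec, ← mulVec_transpose, hM, transpose_matrixPart, dotProduct_comm]
  have huu : u ⬝ᵥ u = s ^ 2 := h0
  have hvv : v ⬝ᵥ v = t ^ 2 := h1
  have huv : u ⬝ᵥ v = 0 := dot_self_cross _ _
  have huw : u ⬝ᵥ w = 0 := dot_self_cross _ _
  have hvw : v ⬝ᵥ w = 0 := dot_cross_self _ _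
  have hww : w ⬝ᵥ w = (s * t) ^ 2 := by
    rw [hw, cross_dot_cross, huu, hvv, huv, dotProduct_comm v u, huv]; ring
  have huMv : u ⬝ᵥ (M *ᵥ v) = 0 := by rw [hMs, dotProduct_comm]; exact dot_cross_self _ _
  have huMw : u ⬝ᵥ (M *ᵥ w) = -t ^ 2 := by
    rw [hMs, ← hvv, dotProduct_comm, hw, triple_product_permutation,
      triple_product_permutation, ← cross_anticomm, ← hv, dotProduct_neg]
  let g : Matrix (Fin 3) (Fin 3) ℂ := Matrix.of ![s⁻¹ • u, t⁻¹ • v, (s * t)⁻¹ • w]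
  have hg0 : g 0 = s⁻¹ • u := rfl
  have hg1 : g 1 = t⁻¹ • v := rfl
  have hg2 : g 2 = (s * t)⁻¹ • w := rfl
  have hggT : g * gᵀ = 1 := by
    have hmul : ∀ i j, (g * gᵀ) i j = g i ⬝ᵥ g j := fun _ _ => rfl
    ext i j
    rw [hmul]
    fin_cases i <;> fin_cases j <;>
      simp [hg0, hg1, hg2, smul_dotProduct, dotProduct_smul, huu, hvv, hww, huv, huw, hvw,
        dotProduct_comm v u, dotProduct_comm w u, dotProduct_comm w v] <;> field_simp
  have hdet : g.det = 1 := by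
    have h : g.det = g 0 ⬝ᵥ crossProduct (g 1) (g 2) := (triple_product_eq_det _ _ _).symm
    have hc : u ⬝ᵥ crossProduct v w = (s * t) ^ 2 := by
      rw [triple_product_permutation, triple_product_permutation, hww]
    rw [h]
    simp [hg0, hg1, hg2, smul_dotProduct, dotProduct_smul, hc]
    field_simp
  refine ⟨g, ⟨mul_eq_one_comm.mp hggT, hdet⟩, ?_⟩
  have hgy : ∀ y i, (g *ᵥ y) i = g i ⬝ᵥ y := fun _ _ => rfl
  have hgM : ∀ i j, (g * M * gᵀ) i j = g i ⬝ᵥ (M *ᵥ g j) := by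
    intro i j
    rw [Matrix.mul_assoc]
    rfl
  have h2 : invariantsAt x 2 = u ⬝ᵥ (M *ᵥ u) := rfl
  have h3 : invariantsAt x 3 = v ⬝ᵥ (M *ᵥ v) := rfl
  have h4 : invariantsAt x 4 = w ⬝ᵥ (M *ᵥ w) := rfl
  have h5 : invariantsAt x 5 = v ⬝ᵥ (M *ᵥ w) := hMs _ _
  rw [symAct_eq, ← hu, ← hM]
  ext i
  fin_cases i <;>
    simp [pairCoords, normalForm, hgy, hgM, h0, h1, h2, h3, h4, h5, hg0, hg1, hg2, smul_dotProduct,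
      dotProduct_smul, mulVec_smul, huu, huMv, huMw, dotProduct_comm v u, dotProduct_comm w u,
      huv, huw] <;> field_simp

/-- The functions of `(s, t, a)`, with `a 0 = s ^ 2` and `a 1 = t ^ 2`, that become a combination
of `1`, `s`, `t`, `s * t` with coefficients polynomial in `a` after multiplication by a power of
`a 0 * a 1`. -/
def IsParityDecomposable (F : ℂ → ℂ → (Fin 6 → ℂ) → ℂ) : Prop :=
  ∃ (N : ℕ) (P : Fin 4 → MvPolynomial (Fin 6) ℂ), ∀ s t a, s ≠ 0 → t ≠ 0 → a 0 = s ^ 2 →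
    a 1 = t ^ 2 → (a 0 * a 1) ^ N * F s t a =
      eval a (P 0) + s * eval a (P 1) + t * eval a (P 2) + s * t * eval a (P 3)

theorem IsParityDecomposable.const (c : ℂ) : IsParityDecomposable fun _ _ _ => c :=
  ⟨0, ![C c, 0, 0, 0], fun s t a _ _ _ _ => by simp⟩

theorem IsParityDecomposable.add {F G : ℂ → ℂ → (Fin 6 → ℂ) → ℂ} (hF : IsParityDecomposable F)
    (hG : IsParityDecomposable G) : IsParityDecomposable fun s t a => F s t a + G s t a := by
  obtain ⟨M, P, hP⟩ := hF
  obtain ⟨N, Q, hQ⟩ := hG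
  refine ⟨M + N, fun k => (X 0 * X 1) ^ N * P k + (X 0 * X 1) ^ M * Q k,
    fun s t a hs ht h0 h1 => ?_⟩
  simp only [map_add, map_mul, map_pow, eval_X, pow_add]
  linear_combination (a 0 * a 1) ^ N * hP s t a hs ht h0 h1 +
    (a 0 * a 1) ^ M * hQ s t a hs ht h0 h1

theorem IsParityDecomposable.mul {F G : ℂ → ℂ → (Fin 6 → ℂ) → ℂ} (hF : IsParityDecomposable F)
    (hG : IsParityDecomposable G) : IsParityDecomposable fun s t a => F s t a * G s t a := by
  obtain ⟨M, P, hP⟩ := hF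
  obtain ⟨N, Q, hQ⟩ := hG
  refine ⟨M + N,
    ![P 0 * Q 0 + X 0 * (P 1 * Q 1) + X 1 * (P 2 * Q 2) + X 0 * X 1 * (P 3 * Q 3),
      P 0 * Q 1 + P 1 * Q 0 + X 1 * (P 2 * Q 3 + P 3 * Q 2),
      P 0 * Q 2 + P 2 * Q 0 + X 0 * (P 1 * Q 3 + P 3 * Q 1),
      P 0 * Q 3 + P 3 * Q 0 + P 1 * Q 2 + P 2 * Q 1], fun s t a hs ht h0 h1 => ?_⟩
  have h : (a 0 * a 1) ^ (M + N) * (F s t a * G s t a) =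
      ((a 0 * a 1) ^ M * F s t a) * ((a 0 * a 1) ^ N * G s t a) := by ring
  rw [h, hP s t a hs ht h0 h1, hQ s t a hs ht h0 h1]
  simp [h0, h1]
  ring

theorem IsParityDecomposable.normalForm (i : Fin 9) :
    IsParityDecomposable fun s t a => normalForm s t a i := by
  refine ⟨1, (![![0, X 0 * X 1, 0, 0], 0, 0, ![X 1 * X 2, 0, 0, 0], 0, ![0, 0, -X 1, 0],
    ![X 0 * X 3, 0, 0, 0], ![0, X 5, 0, 0], ![X 4, 0, 0, 0]] :
      Fin 9 → Fin 4 → MvPolynomial (Fin 6) ℂ) i, fun s t a hs ht h0 h1 => ?_⟩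
  have h0' : a 0 ≠ 0 := by rw [h0]; exact pow_ne_zero 2 hs
  have h1' : a 1 ≠ 0 := by rw [h1]; exact pow_ne_zero 2 ht
  fin_cases i <;> simp [_root_.normalForm] <;> field_simp

theorem IsParityDecomposable.eval_comp {f : ℂ → ℂ → (Fin 6 → ℂ) → Fin 9 → ℂ}
    (hf : ∀ i, IsParityDecomposable fun s t a => f s t a i) (p : MvPolynomial (Fin 9) ℂ) :
    IsParityDecomposable fun s t a => eval (f s t a) p := by
  induction p using MvPolynomial.induction_on with
  | C c => simpa using IsParityDecomposable.const c
  | add p q hp hq => simpa using hp.add hq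
  | mul_X p i hp => simpa using hp.mul (hf i)

theorem IsParityDecomposable.eval_symAct_normalForm (g : Matrix (Fin 3) (Fin 3) ℂ)
    (p : MvPolynomial (Fin 9) ℂ) :
    IsParityDecomposable fun s t a => eval (symAct g (_root_.normalForm s t a)) p := by
  obtain ⟨p', hp'⟩ := exists_eval_symAct g p
  simpa only [← hp'] using eval_comp normalForm p'

theorem invariant_of_mul_aeval_eq {p q : MvPolynomial (Fin 9) ℂ} {P Q : MvPolynomial (Fin 6) ℂ}
    (hQ : aeval symFpoly Q ≠ 0) (h : p * aeval symFpoly Q = aeval symFpoly P * q)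
    {g : Matrix (Fin 3) (Fin 3) ℂ} (hg : SO3 g) (x : Fin 9 → ℂ) :
    eval (symAct g x) p * eval x q = eval x p * eval (symAct g x) q := by
  obtain ⟨p', hp'⟩ := exists_eval_symAct g p
  obtain ⟨q', hq'⟩ := exists_eval_symAct g q
  have hx : ∀ y, eval y p * eval (invariantsAt y) Q = eval (invariantsAt y) P * eval y q := by
    intro y
    simpa only [map_mul, eval_aeval_symFpoly] using congrArg (eval y) h
  have hzero : (p' * q - p * q') * aeval symFpoly Q = 0 := by
    refine MvPolynomial.funext fun y => ?_
    have hgy := hx (symAct g y)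
    rw [invariantsAt_symAct hg] at hgy
    simp only [map_mul, map_sub, eval_aeval_symFpoly, hp', hq', map_zero]
    linear_combination eval y q * hgy - eval (symAct g y) q * hx y
  have := congrArg (eval x) ((mul_eq_zero.mp hzero).resolve_right hQ)
  simp only [map_mul, map_sub, hp', hq', map_zero] at this
  exact sub_eq_zero.mp this

theorem eq_of_forall_signs {s t : ℂ} (hs : s ≠ 0) (ht : t ≠ 0) {A B : Fin 4 → ℂ}
    (h : ∀ ε δ : ℂ, ε ^ 2 = 1 → δ ^ 2 = 1 →
      A 0 + ε * s * A 1 + δ * t * A 2 + ε * s * (δ * t) * A 3 =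
        B 0 + ε * s * B 1 + δ * t * B 2 + ε * s * (δ * t) * B 3) (k : Fin 4) : A k = B k := by
  have h1 := h 1 1 (by norm_num) (by norm_num)
  have h2 := h (-1) 1 (by norm_num) (by norm_num)
  have h3 := h 1 (-1) (by norm_num) (by norm_num)
  have h4 := h (-1) (-1) (by norm_num) (by norm_num)
  fin_cases k
  · show A 0 = B 0
    linear_combination (h1 + h2 + h3 + h4) / 4
  · show A 1 = B 1
    refine mul_left_cancel₀ hs ?_
    linear_combination (h1 - h2 + h3 - h4) / 4
  · show A 2 = B 2
    refine mul_left_cancel₀ ht ?_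
    linear_combination (h1 + h2 - h3 - h4) / 4
  · show A 3 = B 3
    refine mul_left_cancel₀ (mul_ne_zero hs ht) ?_
    linear_combination (h1 - h2 - h3 + h4) / 4

theorem exists_mul_aeval_eq_of_invariant {p q : MvPolynomial (Fin 9) ℂ} (hq : q ≠ 0)
    (hinv : ∀ g : Matrix (Fin 3) (Fin 3) ℂ, SO3 g → ∀ x : Fin 9 → ℂ,
      eval (symAct g x) p * eval x q = eval x p * eval (symAct g x) q) :
    ∃ P Q : MvPolynomial (Fin 6) ℂ, aeval symFpoly Q ≠ 0 ∧
      p * aeval symFpoly Q = aeval symFpoly P * q := by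
  have hf : ∀ i, symFpoly i ≠ 0 := algebraicIndependent_symFpoly.ne_zero
  obtain ⟨x₀, hx₀⟩ : ∃ x, eval x (q * (symFpoly 0 * symFpoly 1)) ≠ 0 := by
    by_contra! h
    exact mul_ne_zero hq (mul_ne_zero (hf 0) (hf 1)) (MvPolynomial.funext (by simpa using h))
  simp only [map_mul, eval_symFpoly, mul_ne_zero_iff] at hx₀
  obtain ⟨hqx₀, h0, h1⟩ := hx₀
  obtain ⟨s₀, hs₀, hs₀'⟩ := exists_sq_eq_of_ne_zero h0
  obtain ⟨t₀, ht₀, ht₀'⟩ := exists_sq_eq_of_ne_zero h1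
  obtain ⟨g₀, hg₀, hgx₀⟩ := exists_SO3_symAct_eq_normalForm hs₀ ht₀ hs₀' ht₀'
  obtain ⟨M, P, hP⟩ := IsParityDecomposable.eval_symAct_normalForm g₀ᵀ p
  obtain ⟨N, Q, hQ⟩ := IsParityDecomposable.eval_symAct_normalForm g₀ᵀ q
  have hsub : ∃ k, eval (invariantsAt x₀) (Q k) ≠ 0 := by
    by_contra! h
    have hx := hQ s₀ t₀ _ hs₀ ht₀ hs₀' ht₀'
    beta_reduce at hx
    rw [← hgx₀, symAct_symAct, hg₀.1, symAct_one] at hx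
    simp [h, h0, h1, hqx₀] at hx
  obtain ⟨k, hk⟩ := hsub
  have hmain : ∀ x, invariantsAt x 0 ≠ 0 → invariantsAt x 1 ≠ 0 →
      eval x p * ((invariantsAt x 0 * invariantsAt x 1) ^ M * eval (invariantsAt x) (Q k)) =
        (invariantsAt x 0 * invariantsAt x 1) ^ N * eval (invariantsAt x) (P k) * eval x q := by
    intro x h0 h1
    obtain ⟨s, hs, hs'⟩ := exists_sq_eq_of_ne_zero h0
    obtain ⟨t, ht, ht'⟩ := exists_sq_eq_of_ne_zero h1
    set a := invariantsAt x
    refine eq_of_forall_signs hs ht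
      (A := fun k => eval x p * ((a 0 * a 1) ^ M * eval a (Q k)))
      (B := fun k => (a 0 * a 1) ^ N * eval a (P k) * eval x q) (fun ε δ hε hδ => ?_) k
    have hεs : ε * s ≠ 0 := mul_ne_zero (by rintro rfl; simp at hε) hs
    have hδt : δ * t ≠ 0 := mul_ne_zero (by rintro rfl; simp at hδ) ht
    have ha0 : a 0 = (ε * s) ^ 2 := by rw [mul_pow, hε, one_mul, hs']
    have ha1 : a 1 = (δ * t) ^ 2 := by rw [mul_pow, hδ, one_mul, ht']
    obtain ⟨g, hg, hgx⟩ := exists_SO3_symAct_eq_normalForm hεs hδt ha0 ha1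
    have hxg := hinv _ (hg₀.transpose.mul hg) x
    rw [← symAct_symAct, hgx] at hxg
    linear_combination -(eval x p * (a 0 * a 1) ^ M) * hQ _ _ a hεs hδt ha0 ha1 +
      eval x q * (a 0 * a 1) ^ N * hP _ _ a hεs hδt ha0 ha1 -
      (a 0 * a 1) ^ M * (a 0 * a 1) ^ N * hxg
  refine ⟨(X 0 * X 1) ^ N * P k, (X 0 * X 1) ^ M * Q k, fun h => ?_, ?_⟩
  · have := congrArg (eval x₀) h
    rw [eval_aeval_symFpoly] at this
    simp [h0, h1, hk] at this
  · refine mul_right_cancel₀ (mul_ne_zero (hf 0) (hf 1)) (MvPolynomial.funext fun x => ?_)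
    simp only [map_mul _ _ (symFpoly _), map_mul (eval x), eval_aeval_symFpoly, eval_symFpoly]
    by_cases h0 : invariantsAt x 0 = 0
    · simp [h0]
    by_cases h1 : invariantsAt x 1 = 0
    · simp [h1]
    simp only [map_mul, map_pow, eval_X]
    rw [hmain x h0 h1]

/-- The field of rational SO₃(ℂ)-invariants of symmetric mixed states of two qubits is
exactly `ℂ(f₁, …, f₆)`; in particular it is purely transcendental of transcendence
degree 6 over ℂ.  A rational function `p/q` is invariant iff as a rational function it
lies in the subfield generated by `f₁, …, f₆`, and the `fᵢ` are algebraically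
independent. -/
theorem symmetric_invariant_field_rational :
    AlgebraicIndependent ℂ symFpoly ∧
      ∀ p q : MvPolynomial (Fin 9) ℂ, q ≠ 0 →
        ((∀ g : Matrix (Fin 3) (Fin 3) ℂ, SO3 g → ∀ x : Fin 9 → ℂ,
            eval (symAct g x) p * eval x q = eval x p * eval (symAct g x) q) ↔
          ∃ P Q : MvPolynomial (Fin 6) ℂ, aeval symFpoly Q ≠ 0 ∧
            p * aeval symFpoly Q = aeval symFpoly P * q) := by
  exact ⟨algebraicIndependent_symFpoly, fun _ _ hq => ⟨exists_mul_aeval_eq_of_invariant hq,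
    fun ⟨_, _, hQ, h⟩ _ hg x => invariant_of_mul_aeval_eq hQ h hg x⟩⟩
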